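/- Let γ0 = (1 5 3)(6 9 13)(2 8 11)(4 7 10), γ1 = (1 4)(2 5)(3 6)(7 9)(8 10)(11 12) and γ∞ = (1 10 2)(3 13 9 4)(5 11 12 8 7 6) be permutations of {1,…,13}. Then the composite applying first γ0, then γ1, then γ∞ is the identity permutation, and the subgroup of S_13 generated by γ0, γ1, γ∞ equals the alternating group A_13. -/

import Mathlib

/- Relabel {1,…,13} as `Fin 13` via i ↦ i - 1. -/

/-- γ0 = (1 5 3)(6 9 13)(2 8 11)(4 7 10) -/
def γ₀ : Equiv.Perm (Fin 13) :=
  List.formPerm [0, 4, 2] * List.formPerm [5, 8, 12] *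
    List.formPerm [1, 7, 10] * List.formPerm [3, 6, 9]

/-- γ1 = (1 4)(2 5)(3 6)(7 9)(8 10)(11 12) -/
def γ₁ : Equiv.Perm (Fin 13) :=
  List.formPerm [0, 3] * List.formPerm [1, 4] * List.formPerm [2, 5] *
    List.formPerm [6, 8] * List.formPerm [7, 9] * List.formPerm [10, 11]

/-- γ∞ = (1 10 2)(3 13 9 4)(5 11 12 8 7 6) -/
def γinf : Equiv.Perm (Fin 13) :=
  List.formPerm [0, 9, 1] * List.formPerm [2, 12, 8, 3] *
    List.formPerm [4, 10, 11, 7, 6, 5]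

open Equiv.Perm in
theorem isThreeCycle_word : IsThreeCycle ((γ₀ * γ₁ * γinf ^ 4) ^ 4) := by
  rw [← card_support_eq_three_iff]
  decide +kernel

theorem exists_word_apply_zero (x : Fin 13) :
    ∃ i j k : Fin 6, (γinf ^ (i : ℕ) * γ₁ ^ (j : ℕ) * γinf ^ (k : ℕ)) 0 = x := by
  revert x
  decide +kernel

/-- Applying first γ0, then γ1, then γ∞ is the identity, and γ0, γ1, γ∞ generate
the alternating group A₁₃. -/
theorem stmt3 :
    γinf * γ₁ * γ₀ = 1 ∧
    Subgroup.closure {γ₀, γ₁, γinf} = alternatingGroup (Fin 13) := by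
  refine ⟨by decide +kernel, le_antisymm ?_ ?_⟩
  · rw [Subgroup.closure_le]
    rintro g (rfl | rfl | rfl) <;>
      exact Equiv.Perm.mem_alternatingGroup.mpr (by decide +kernel)
  · set G := Subgroup.closure {γ₀, γ₁, γinf}
    have h₀ : γ₀ ∈ G := Subgroup.subset_closure (by simp)
    have h₁ : γ₁ ∈ G := Subgroup.subset_closure (by simp)
    have hinf : γinf ∈ G := Subgroup.subset_closure (by simp)
    have htrans : MulAction.IsPretransitive G (Fin 13) := by
      refine (MulAction.isPretransitive_iff_base 0).mpr fun x ↦ ?_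
      obtain ⟨i, j, k, h⟩ := exists_word_apply_zero x
      exact ⟨⟨_, mul_mem (mul_mem (pow_mem hinf _) (pow_mem h₁ _)) (pow_mem hinf _)⟩, h⟩
    have hprim : MulAction.IsPreprimitive G (Fin 13) :=
      MulAction.IsPreprimitive.of_prime_card (by rw [Nat.card_fin]; norm_num)
    exact Equiv.Perm.alternatingGroup_le_of_isPreprimitive_of_isThreeCycle_mem hprim
      isThreeCycle_word (pow_mem (mul_mem (mul_mem h₀ h₁) (pow_mem hinf _)) _)
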